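/- Let M ∈ ℝ^{n×n} be nonnegative, let I = (i_1,…,i_m) be a tuple of m ≤ n pairwise distinct indices, and let M_I ∈ ℝ^{m×m} be the principal submatrix with entries (M_I)_{kl} = M_{i_k i_l}. Then ν_C(M) ≥ ρ(M_I)/m, where ρ denotes the spectral radius. -/

import Mathlib

open Matrix BigOperators

/-- `ν_C(M)`: the reciprocal of the minimal trace of a nonnegative diagonal
perturbation `Δ` making `I - Δ M` singular (`ν_C(M) = 0` if no such `Δ` exists). -/
noncomputable def nuC {n : ℕ} (M : Matrix (Fin n) (Fin n) ℝ) : ℝ :=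
  (sInf {s : ℝ | ∃ δ : Fin n → ℝ, (∀ i, 0 ≤ δ i) ∧
      (1 - Matrix.diagonal δ * M).det = 0 ∧ s = ∑ i, δ i})⁻¹

/-- The spectral radius of a real square matrix: the maximum modulus of its
complex eigenvalues. -/
noncomputable def specRad {n : ℕ} (M : Matrix (Fin n) (Fin n) ℝ) : ℝ :=
  (spectralRadius ℂ (M.map (Complex.ofReal ·))).toReal

/-- Nonnegative `y` with `r y ≤ A y`, positive `z` with `r⁻¹ A z < z`: then `y = 0`. -/
lemma eq_zero_of_smul_le_mulVec_of_lt {ι : Type*} [Fintype ι]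
    (A : Matrix ι ι ℝ) (hA : ∀ i j, 0 ≤ A i j) (r : ℝ) (y z : ι → ℝ) (hy : ∀ i, 0 ≤ y i)
    (hz : ∀ i, 0 < z i) (hry : ∀ i, r * y i ≤ (A *ᵥ y) i) (hrz : ∀ i, (A *ᵥ z) i < r * z i) :
    y = 0 := by
  by_contra hne
  obtain ⟨k, hk⟩ := Function.ne_iff.mp hne
  have hk' : 0 < y k := lt_of_le_of_ne (hy k) (Ne.symm hk)
  have : Nonempty ι := ⟨k⟩
  obtain ⟨i, hi⟩ := Finite.exists_max fun j => y j / z j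
  have hc : 0 < y i / z i := (div_pos hk' (hz k)).trans_le (hi k)
  have hle : (A *ᵥ y) i ≤ y i / z i * (A *ᵥ z) i := by
    simp only [mulVec, dotProduct, Finset.mul_sum]
    refine Finset.sum_le_sum fun j _ => ?_
    have h := mul_le_mul_of_nonneg_left ((div_le_iff₀ (hz j)).mp (hi j)) (hA i j)
    linarith
  have h1 := mul_lt_mul_of_pos_left (hrz i) hc
  have h2 : y i / z i * (r * z i) = r * y i := by
    have := (hz i).ne'
    field_simp
  linarith [hry i]

/-- If `1 - t A` is nonsingular for all `t ∈ [0, T]`, the solution of `(1 - T A) z = 1` for a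
nonnegative matrix `A` is positive. -/
lemma exists_pos_eq_one_add_smul_mulVec {ι : Type*} [Fintype ι] [DecidableEq ι]
    (A : Matrix ι ι ℝ) (hA : ∀ i j, 0 ≤ A i j) {T : ℝ} (hT : 0 ≤ T)
    (hdet : ∀ t ∈ Set.Icc 0 T, (1 - t • A).det ≠ 0) :
    ∃ z : ι → ℝ, (∀ i, 0 < z i) ∧ ∀ i, z i = 1 + T * (A *ᵥ z) i := by
  let z : ℝ → ι → ℝ := fun t => ((1 - t • A).det)⁻¹ • ((1 - t • A).adjugate *ᵥ 1)
  have hz : ∀ t ∈ Set.Icc 0 T, ∀ i, z t i = 1 + t * (A *ᵥ z t) i := by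
    intro t ht i
    have h : (1 - t • A) *ᵥ z t = 1 := by
      simp only [z]
      rw [mulVec_smul, mulVec_mulVec, mul_adjugate, smul_mulVec, one_mulVec, smul_smul,
        inv_mul_cancel₀ (hdet t ht), one_smul]
    have h := congrFun h i
    rw [sub_mulVec, one_mulVec, smul_mulVec] at h
    simp only [Pi.sub_apply, Pi.smul_apply, smul_eq_mul, Pi.one_apply] at h
    linarith
  have hcM : Continuous fun t : ℝ => 1 - t • A := by fun_prop
  have hcont : ContinuousOn z (Set.Icc 0 T) :=
    (hcM.matrix_det.continuousOn.inv₀ hdet).smul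
      (hcM.matrix_adjugate.matrix_mulVec continuous_const).continuousOn
  have hge : ∀ t ∈ Set.Icc 0 T, (∀ i, 0 ≤ z t i) → ∀ i, 1 ≤ z t i := by
    intro t ht h i
    have hs : 0 ≤ (A *ᵥ z t) i := Finset.sum_nonneg fun j _ => mul_nonneg (hA i j) (h j)
    rw [hz t ht i]
    nlinarith [mul_nonneg ht.1 hs]
  have hconn : IsPreconnected (z '' Set.Icc 0 T) := isPreconnected_Icc.image z hcont
  have hopen : IsOpen {w : ι → ℝ | ∀ i, 0 < w i} := by
    simp only [Set.ofPred_forall]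
    exact isOpen_iInter_of_finite fun i => isOpen_lt continuous_const (continuous_apply i)
  have hclosed : IsClosed {w : ι → ℝ | ∀ i, 0 ≤ w i} := by
    simp only [Set.ofPred_forall]
    exact isClosed_iInter fun i => isClosed_le continuous_const (continuous_apply i)
  have hpos : ∀ i, 0 < z T i := by
    by_contra hneg
    have hneg' : ¬ ∀ i, 0 ≤ z T i := fun h =>
      hneg fun i => one_pos.trans_le (hge T ⟨hT, le_rfl⟩ h i)
    have hcover : z '' Set.Icc 0 T ⊆
        {w : ι → ℝ | ∀ i, 0 < w i} ∪ {w : ι → ℝ | ∀ i, 0 ≤ w i}ᶜ := by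
      rintro _ ⟨t, ht, rfl⟩
      by_cases h : ∀ i, 0 ≤ z t i
      · exact Or.inl fun i => one_pos.trans_le (hge t ht h i)
      · exact Or.inr h
    have h0 : ∀ i, 0 < z 0 i := fun i => by
      rw [hz 0 ⟨le_rfl, hT⟩ i]
      simp
    obtain ⟨w, -, hw1, hw2⟩ := hconn _ _ hopen hclosed.isOpen_compl hcover
      ⟨z 0, ⟨0, ⟨le_rfl, hT⟩, rfl⟩, h0⟩ ⟨z T, ⟨T, ⟨hT, le_rfl⟩, rfl⟩, hneg'⟩
    exact hw2 fun i => (hw1 i).le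
  exact ⟨z T, hpos, hz T ⟨hT, le_rfl⟩⟩

/-- The spectral radius of a nonempty real matrix is the modulus of a complex eigenvalue. -/
lemma exists_mulVec_eq_smul_norm_eq_specRad {m : ℕ} (hm : 1 ≤ m) (A : Matrix (Fin m) (Fin m) ℝ) :
    ∃ (c : ℂ) (x : Fin m → ℂ), x ≠ 0 ∧ A.map (Complex.ofReal ·) *ᵥ x = c • x ∧
      ‖c‖ = specRad A := by
  have : NeZero m := ⟨by omega⟩
  let : NormedRing (Matrix (Fin m) (Fin m) ℂ) := Matrix.linftyOpNormedRing
  let : NormedAlgebra ℂ (Matrix (Fin m) (Fin m) ℂ) := Matrix.linftyOpNormedAlgebra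
  have : CompleteSpace (Matrix (Fin m) (Fin m) ℂ) := FiniteDimensional.complete ℂ _
  obtain ⟨c, hc, hcr⟩ := spectrum.exists_nnnorm_eq_spectralRadius (A.map (Complex.ofReal ·))
  rw [spectrum.mem_iff, Matrix.isUnit_iff_isUnit_det, isUnit_iff_ne_zero, not_not] at hc
  obtain ⟨x, hx, hx0⟩ := exists_mulVec_eq_zero_iff.mpr hc
  refine ⟨c, x, hx, ?_, ?_⟩
  · rw [sub_mulVec, sub_eq_zero, Algebra.algebraMap_eq_smul_one, smul_mulVec, one_mulVec] at hx0
    exact hx0.symm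
  · rw [specRad, ← hcr]
    simp

/-- A nonnegative matrix with positive spectral radius `r` satisfies `det (1 - t A) = 0` for
some `t ∈ [0, r⁻¹]`. -/
lemma exists_det_one_sub_smul_eq_zero {m : ℕ} (hm : 1 ≤ m) (A : Matrix (Fin m) (Fin m) ℝ)
    (hA : ∀ i j, 0 ≤ A i j) (hr : 0 < specRad A) :
    ∃ t ∈ Set.Icc 0 (specRad A)⁻¹, (1 - t • A).det = 0 := by
  by_contra! hdet
  obtain ⟨c, x, hx, hcx, hc⟩ := exists_mulVec_eq_smul_norm_eq_specRad hm A
  obtain ⟨z, hz, hzeq⟩ := exists_pos_eq_one_add_smul_mulVec A hA (inv_nonneg.mpr hr.le) hdet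
  have hy := eq_zero_of_smul_le_mulVec_of_lt A hA (specRad A) (fun i => ‖x i‖) z
    (fun i => norm_nonneg _) hz ?_ ?_
  · exact hx (funext fun i => norm_eq_zero.mp (congrFun hy i))
  · intro i
    have h := congrArg norm (congrFun hcx i)
    rw [Pi.smul_apply, norm_smul, hc] at h
    rw [← h]
    simp only [mulVec, dotProduct]
    refine (norm_sum_le _ _).trans (Finset.sum_le_sum fun j _ => ?_)
    simp [abs_of_nonneg (hA i j)]
  · intro i
    have h : specRad A * z i = specRad A + (A *ᵥ z) i := by
      rw [hzeq i]
      field_simp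
    linarith

/-- The perturbation traces occurring in `nuC` are bounded away from zero. -/
lemma one_le_sum_mul_sum_of_det_eq_zero {ι : Type*} [Fintype ι] [DecidableEq ι]
    (M : Matrix ι ι ℝ) (hM : ∀ i j, 0 ≤ M i j) (δ : ι → ℝ) (hδ : ∀ i, 0 ≤ δ i)
    (hdet : (1 - diagonal δ * M).det = 0) : 1 ≤ (∑ i, ∑ j, M i j) * ∑ i, δ i := by
  obtain ⟨v, hv, hv0⟩ := exists_mulVec_eq_zero_iff.mpr hdet
  obtain ⟨k, hk⟩ := Function.ne_iff.mp hv
  have : Nonempty ι := ⟨k⟩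
  obtain ⟨i, hi⟩ := Finite.exists_max fun j => |v j|
  have hvi : 0 < |v i| := (abs_pos.mpr hk).trans_le (hi k)
  rw [sub_mulVec, sub_eq_zero, one_mulVec, ← mulVec_mulVec] at hv0
  have h := congrArg abs (congrFun hv0 i)
  rw [mulVec_diagonal, abs_mul, abs_of_nonneg (hδ i)] at h
  have hs : |(M *ᵥ v) i| ≤ (∑ j, M i j) * |v i| := by
    rw [Finset.sum_mul]
    refine (Finset.abs_sum_le_sum_abs _ _).trans (Finset.sum_le_sum fun j _ => ?_)
    rw [abs_mul, abs_of_nonneg (hM i j)]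
    exact mul_le_mul_of_nonneg_left (hi j) (hM i j)
  have h1 : 1 ≤ δ i * ∑ j, M i j := by
    refine le_of_mul_le_mul_right ?_ hvi
    linarith [mul_le_mul_of_nonneg_left hs (hδ i)]
  have hrow : ∑ j, M i j ≤ ∑ i, ∑ j, M i j :=
    Finset.single_le_sum (f := fun i => ∑ j, M i j)
      (fun i _ => Finset.sum_nonneg fun j _ => hM i j) (Finset.mem_univ i)
  have hδi : δ i ≤ ∑ i, δ i := Finset.single_le_sum (fun i _ => hδ i) (Finset.mem_univ i)
  rw [mul_comm]
  exact h1.trans (mul_le_mul hδi hrow (Finset.sum_nonneg fun j _ => hM i j)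
    (Finset.sum_nonneg fun i _ => hδ i))

/-- A singular perturbation `1 - t M_I` of a principal submatrix extends by zero to a singular
perturbation of the whole matrix. -/
lemma det_one_sub_diagonal_extend_mul_eq_zero {ι κ : Type*} [Fintype ι] [DecidableEq ι]
    [Fintype κ] [DecidableEq κ] (M : Matrix ι ι ℝ) (e : κ → ι) (he : Function.Injective e)
    (t : ℝ) (hdet : (1 - t • M.submatrix e e).det = 0) :
    (1 - diagonal (Function.extend e (fun _ => t) 0) * M).det = 0 := by
  obtain ⟨v, hv, hv0⟩ := exists_mulVec_eq_zero_iff.mpr hdet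
  rw [sub_mulVec, sub_eq_zero, one_mulVec, smul_mulVec] at hv0
  refine exists_mulVec_eq_zero_iff.mp ⟨Function.extend e v 0, fun h => hv (funext fun k => ?_), ?_⟩
  · rw [← he.extend_apply v 0 k, h]
    rfl
  · rw [sub_mulVec, sub_eq_zero, one_mulVec, ← mulVec_mulVec]
    ext i
    rw [mulVec_diagonal]
    by_cases hi : ∃ k, e k = i
    · obtain ⟨k, rfl⟩ := hi
      rw [he.extend_apply, he.extend_apply, congrFun hv0 k]
      simp only [Pi.smul_apply, smul_eq_mul, mulVec, dotProduct, submatrix_apply]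
      congr 1
      refine Fintype.sum_of_injective e he _ _ (fun j hj => ?_) fun l => ?_
      · rw [Function.extend_apply' _ _ _ hj]
        simp
      · rw [he.extend_apply]
    · rw [Function.extend_apply' _ _ _ hi, Function.extend_apply' _ _ _ hi]
      simp

/-- Let `M ∈ ℝ^{n×n}` be nonnegative and let `e : Fin m → Fin n` be an injective
tuple of `m ≤ n` pairwise distinct indices, giving the principal submatrix
`M_I = M.submatrix e e`.  Then `ν_C(M) ≥ ρ(M_I)/m`. -/
theorem nuC_ge_specRad_submatrix_div {n m : ℕ} (hn : 1 ≤ n) (hm : 1 ≤ m)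
    (hmn : m ≤ n) (M : Matrix (Fin n) (Fin n) ℝ) (hM : ∀ i j, 0 ≤ M i j)
    (e : Fin m → Fin n) (he : Function.Injective e) :
    specRad (M.submatrix e e) / m ≤ nuC M := by
  have hnn : ∀ s ∈ {s : ℝ | ∃ δ : Fin n → ℝ, (∀ i, 0 ≤ δ i) ∧
      (1 - Matrix.diagonal δ * M).det = 0 ∧ s = ∑ i, δ i}, 0 ≤ s := by
    rintro s ⟨δ, hδ, -, rfl⟩
    exact Finset.sum_nonneg fun i _ => hδ i
  have hm0 : (0 : ℝ) < m := by exact_mod_cast hm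
  have hr0 : 0 ≤ specRad (M.submatrix e e) := ENNReal.toReal_nonneg
  rcases hr0.eq_or_lt with hr | hr
  · rw [← hr, zero_div]
    exact inv_nonneg.mpr (Real.sInf_nonneg hnn)
  obtain ⟨t, ht, hdet⟩ := exists_det_one_sub_smul_eq_zero hm (M.submatrix e e)
    (fun i j => hM _ _) hr
  have hmem : m * t ∈ {s : ℝ | ∃ δ : Fin n → ℝ, (∀ i, 0 ≤ δ i) ∧
      (1 - Matrix.diagonal δ * M).det = 0 ∧ s = ∑ i, δ i} := by
    refine ⟨Function.extend e (fun _ => t) 0, fun i => ?_,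
      det_one_sub_diagonal_extend_mul_eq_zero M e he t hdet, ?_⟩
    · by_cases hi : ∃ k, e k = i
      · obtain ⟨k, rfl⟩ := hi
        rw [he.extend_apply]
        exact ht.1
      · rw [Function.extend_apply' _ _ _ hi]
        rfl
    · rw [← Fintype.sum_of_injective e he (fun _ => t) _
        (fun j hj => by rw [Function.extend_apply' _ _ _ hj]; rfl)
        fun l => (he.extend_apply (fun _ => t) 0 l).symm]
      simp
  have hle : sInf _ ≤ m * t := csInf_le ⟨0, hnn⟩ hmem
  have hK : ∀ s ∈ {s : ℝ | ∃ δ : Fin n → ℝ, (∀ i, 0 ≤ δ i) ∧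
      (1 - Matrix.diagonal δ * M).det = 0 ∧ s = ∑ i, δ i},
      1 ≤ (∑ i, ∑ j, M i j) * s := by
    rintro s ⟨δ, hδ, hs, rfl⟩
    exact one_le_sum_mul_sum_of_det_eq_zero M hM δ hδ hs
  have hKpos : 0 < ∑ i, ∑ j, M i j :=
    pos_of_mul_pos_left (one_pos.trans_le (hK _ hmem)) (hnn _ hmem)
  have hpos := (inv_pos.mpr hKpos).trans_le
    (le_csInf ⟨_, hmem⟩ fun s hs => (inv_le_iff_one_le_mul₀' hKpos).mpr (hK s hs))
  rw [nuC, ← inv_div]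
  refine inv_anti₀ hpos (hle.trans ?_)
  rw [div_eq_mul_inv]
  exact mul_le_mul_of_nonneg_left ht.2 hm0.le
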